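/- Let N = 2 and let (a^V,e^V) and (a^W,e^W) be A-module structures on I×{0,1,2}-graded spaces V and W, with every e^V_{i,n} invertible. Let K := { λ ∈ L(W₂,V₀) : for all h ∈ H, λ_{s(h)}∘a^W_{h̄,1} = (e^V_{s(h),0})⁻¹∘a^V_{h̄,0}∘λ_{t(h)}∘e^W_{t(h),1} }. Then the map sending a graded homomorphism μ : W → V to λ := ((e^V_{i,0})⁻¹∘(e^V_{i,1})⁻¹∘μ_{i,2})_{i∈I} is a linear isomorphism from the space of graded homomorphisms W → V onto K. Consequently the cokernel of ∂₁ is naturally isomorphic to the dual of the space of graded homomorphisms W → V. -/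

import Mathlib

noncomputable section

/-- Cast of graded components of an `I × ℕ`-graded family of `ℂ`-vector spaces along an
equality of vertices. -/
def lcastN {I : Type} (V : I → ℕ → Type)
    [∀ i n, AddCommGroup (V i n)] [∀ i n, Module ℂ (V i n)]
    (n : ℕ) {i j : I} (hij : i = j) : V i n ≃ₗ[ℂ] V j n := by
  subst hij; exact LinearEquiv.refl ℂ (V i n)

section Maps

variable {I H : Type} [DecidableEq I] [Fintype H]
  (s t : H → I) (bar : H → H)
  (s_bar : ∀ h, s (bar h) = t h) (t_bar : ∀ h, t (bar h) = s h)
  (eps : H → ℤ)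
  (V W : I → ℕ → Type)
  [∀ i n, AddCommGroup (V i n)] [∀ i n, Module ℂ (V i n)]
  [∀ i n, AddCommGroup (W i n)] [∀ i n, Module ℂ (W i n)]
  (aV : ∀ (h : H) (n : ℕ), V (s h) n →ₗ[ℂ] V (t h) (n + 1))
  (eV : ∀ (i : I) (n : ℕ), V i n →ₗ[ℂ] V i (n + 1))
  (aW : ∀ (h : H) (n : ℕ), W (s h) n →ₗ[ℂ] W (t h) (n + 1))
  (eW : ∀ (i : I) (n : ℕ), W i n →ₗ[ℂ] W i (n + 1))
  (eVinv : ∀ (i : I) (n : ℕ), V i (n + 1) →ₗ[ℂ] V i n)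

/-- The map `∂₁ : E(V₀,W₁) → L(V₀,W₂)`, bundled as a linear map. -/
def d1L : (∀ h, V (s h) 0 →ₗ[ℂ] W (t h) 1) →ₗ[ℂ] (∀ k, V k 0 →ₗ[ℂ] W k 2) :=
  LinearMap.pi fun k => ∑ h : H, if hk : t h = k then
    (eps h : ℂ) • (
      (LinearMap.llcomp ℂ (V k 0) (W (t (bar h)) 1) (W k 2)
          ((lcastN W 2 hk).toLinearMap ∘ₗ aW h 1 ∘ₗ (lcastN W 1 (t_bar h)).toLinearMap))
        ∘ₗ (LinearMap.lcomp ℂ (W (t (bar h)) 1)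
          ((lcastN V 0 ((s_bar h).trans hk)).symm.toLinearMap))
        ∘ₗ (LinearMap.proj (bar h))
      +
      (LinearMap.llcomp ℂ (V k 0) (W (t h) 1) (W k 2)
          ((lcastN W 2 hk).toLinearMap ∘ₗ eW (t h) 1))
        ∘ₗ (LinearMap.lcomp ℂ (W (t h) 1)
          (eVinv (s h) 0 ∘ₗ (lcastN V 1 (t_bar h)).toLinearMap ∘ₗ aV (bar h) 0
            ∘ₗ (lcastN V 0 ((s_bar h).trans hk)).symm.toLinearMap))
        ∘ₗ (LinearMap.proj h))
  else 0

/-- The subspace `K ⊆ L(W₂,V₀)` of maps `λ` with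
`λ_{s(h)}∘a^W_{h̄,1} = (e^V_{s(h),0})⁻¹∘a^V_{h̄,0}∘λ_{t(h)}∘e^W_{t(h),1}` for all `h`. -/
def Ksub : Submodule ℂ (∀ i, W i 2 →ₗ[ℂ] V i 0) :=
  ⨅ h : H, LinearMap.ker
    ((LinearMap.lcomp ℂ (V (s h) 0)
        ((lcastN W 2 (t_bar h)).toLinearMap ∘ₗ aW (bar h) 1)) ∘ₗ LinearMap.proj (s h)
      -
      ((LinearMap.llcomp ℂ (W (s (bar h)) 1) (V (t h) 0) (V (s h) 0)
          (eVinv (s h) 0 ∘ₗ (lcastN V 1 (t_bar h)).toLinearMap ∘ₗ aV (bar h) 0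
            ∘ₗ (lcastN V 0 (s_bar h)).symm.toLinearMap))
        ∘ₗ (LinearMap.lcomp ℂ (V (t h) 0)
            (eW (t h) 1 ∘ₗ (lcastN W 1 (s_bar h)).toLinearMap))
        ∘ₗ LinearMap.proj (t h)))

/-- The space of graded homomorphisms `W → V` (for the grading `{0,1,2}`), realized as a
submodule of `∏_{i,n} Hom(W_{i,n}, V_{i,n})`. -/
def GHomWV : Submodule ℂ (∀ (i : I) (n : Fin 3), W i (n : ℕ) →ₗ[ℂ] V i (n : ℕ)) :=
  (⨅ i : I, ⨅ n : Fin 2, LinearMap.ker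
      ((LinearMap.lcomp ℂ (V i ((n : ℕ) + 1)) (eW i n))
          ∘ₗ (LinearMap.proj (⟨(n : ℕ) + 1, Nat.succ_lt_succ n.2⟩ : Fin 3))
          ∘ₗ (LinearMap.proj i)
        - (LinearMap.llcomp ℂ (W i (n : ℕ)) (V i (n : ℕ)) (V i ((n : ℕ) + 1)) (eV i n))
          ∘ₗ (LinearMap.proj (⟨(n : ℕ), Nat.lt_succ_of_lt n.2⟩ : Fin 3))
          ∘ₗ (LinearMap.proj i)))
  ⊓
  (⨅ h : H, ⨅ n : Fin 2, LinearMap.ker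
      ((LinearMap.lcomp ℂ (V (t h) ((n : ℕ) + 1)) (aW h n))
          ∘ₗ (LinearMap.proj (⟨(n : ℕ) + 1, Nat.succ_lt_succ n.2⟩ : Fin 3))
          ∘ₗ (LinearMap.proj (t h))
        - (LinearMap.llcomp ℂ (W (s h) (n : ℕ)) (V (s h) (n : ℕ)) (V (t h) ((n : ℕ) + 1))
            (aV h n))
          ∘ₗ (LinearMap.proj (⟨(n : ℕ), Nat.lt_succ_of_lt n.2⟩ : Fin 3))
          ∘ₗ (LinearMap.proj (s h))))

end Maps

section Aux

variable {I H : Type} [DecidableEq I] [Fintype H]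
  (s t : H → I) (bar : H → H)
  (s_bar : ∀ h, s (bar h) = t h) (t_bar : ∀ h, t (bar h) = s h)
  (eps : H → ℤ)
  (V W : I → ℕ → Type)
  [∀ i n, AddCommGroup (V i n)] [∀ i n, Module ℂ (V i n)]
  [∀ i n, AddCommGroup (W i n)] [∀ i n, Module ℂ (W i n)]
  (aV : ∀ (h : H) (n : ℕ), V (s h) n →ₗ[ℂ] V (t h) (n + 1))
  (eV : ∀ (i : I) (n : ℕ), V i n →ₗ[ℂ] V i (n + 1))
  (aW : ∀ (h : H) (n : ℕ), W (s h) n →ₗ[ℂ] W (t h) (n + 1))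
  (eW : ∀ (i : I) (n : ℕ), W i n →ₗ[ℂ] W i (n + 1))
  (eVinv : ∀ (i : I) (n : ℕ), V i (n + 1) →ₗ[ℂ] V i n)

theorem lcastN_rfl (n : ℕ) (i : I) (h : i = i) : lcastN V n h = LinearEquiv.refl ℂ (V i n) := rfl

def auxX (l : ∀ i, W i 2 →ₗ[ℂ] V i 0) (g : H) : W (t g) 1 →ₗ[ℂ] V (s g) 0 :=
  eVinv (s g) 0 ∘ₗ (lcastN V 1 (t_bar g)).toLinearMap ∘ₗ aV (bar g) 0
    ∘ₗ (lcastN V 0 (s_bar g)).symm.toLinearMap ∘ₗ l (t g) ∘ₗ eW (t g) 1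
  - l (s g) ∘ₗ (lcastN W 2 (t_bar g)).toLinearMap ∘ₗ aW (bar g) 1
    ∘ₗ (lcastN W 1 (s_bar g)).symm.toLinearMap

theorem mem_Ksub_iff (l : ∀ i, W i 2 →ₗ[ℂ] V i 0) :
    l ∈ Ksub s t bar s_bar t_bar V W aV aW eW eVinv ↔
      ∀ g, auxX s t bar s_bar t_bar V W aV aW eW eVinv l g = 0 := by
  unfold Ksub auxX
  simp only [Submodule.mem_iInf, LinearMap.mem_ker]
  refine forall_congr' fun g => ?_
  constructor
  · intro h
    ext x
    have := LinearMap.congr_fun h ((lcastN W 1 (s_bar g)).symm x)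
    simp [sub_eq_zero] at this ⊢
    exact this.symm
  · intro h
    ext x
    have := LinearMap.congr_fun h (lcastN W 1 (s_bar g) x)
    simp [sub_eq_zero] at this ⊢
    exact this.symm

theorem auxX_gen (l : ∀ i, W i 2 →ₗ[ℂ] V i 0) (g : H) (p q : I) (hp : t g = p) (hq : s g = q) :
    (eVinv p 0 ∘ₗ (lcastN V 1 hp).toLinearMap ∘ₗ aV g 0
      ∘ₗ (lcastN V 0 hq).symm.toLinearMap ∘ₗ l q ∘ₗ eW q 1
    - l p ∘ₗ (lcastN W 2 hp).toLinearMap ∘ₗ aW g 1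
      ∘ₗ (lcastN W 1 hq).symm.toLinearMap = 0) ↔
    ∀ x, eVinv (t g) 0 (aV g 0 (l (s g) (eW (s g) 1 x))) = l (t g) (aW g 1 x) := by
  subst hp hq
  simp [lcastN_rfl, LinearMap.ext_iff, sub_eq_zero]

theorem mem_Ksub_iff' (bar_invol : ∀ h, bar (bar h) = h) (l : ∀ i, W i 2 →ₗ[ℂ] V i 0) :
    l ∈ Ksub s t bar s_bar t_bar V W aV aW eW eVinv ↔
      ∀ g x, eVinv (t g) 0 (aV g 0 (l (s g) (eW (s g) 1 x))) = l (t g) (aW g 1 x) := by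
  rw [mem_Ksub_iff]
  have key := fun g => auxX_gen s t V W aV aW eW eVinv l (bar g) (s g) (t g) (t_bar g) (s_bar g)
  constructor
  · intro h g
    have := (key (bar g)).1 (h (bar g))
    rwa [bar_invol] at this
  · intro h g
    exact (key g).2 (h (bar g))

theorem mem_GHom_iff (μ : ∀ (i : I) (n : Fin 3), W i (n : ℕ) →ₗ[ℂ] V i (n : ℕ)) :
    μ ∈ GHomWV s t V W aV eV aW eW ↔
    ((∀ i, (∀ x, μ i 1 (eW i 0 x) = eV i 0 (μ i 0 x)) ∧
        (∀ x, μ i 2 (eW i 1 x) = eV i 1 (μ i 1 x))) ∧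
     (∀ h, (∀ x, μ (t h) 1 (aW h 0 x) = aV h 0 (μ (s h) 0 x)) ∧
        (∀ x, μ (t h) 2 (aW h 1 x) = aV h 1 (μ (s h) 1 x)))) := by
  unfold GHomWV
  simp only [Submodule.mem_inf, Submodule.mem_iInf, LinearMap.mem_ker, Fin.forall_fin_two,
    LinearMap.ext_iff, LinearMap.sub_apply, LinearMap.zero_apply, sub_eq_zero]
  exact Iff.rfl

variable [Fintype I]

def trPair : (∀ i, W i 2 →ₗ[ℂ] V i 0) →ₗ[ℂ] Module.Dual ℂ (∀ k, V k 0 →ₗ[ℂ] W k 2) :=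
  LinearMap.mk₂ ℂ (fun l φ => ∑ k, LinearMap.trace ℂ (V k 0) (l k ∘ₗ φ k))
    (by intros; simp [LinearMap.add_comp, Finset.sum_add_distrib])
    (by intros; simp [LinearMap.smul_comp, Finset.mul_sum])
    (by intros; simp [LinearMap.comp_add, Finset.sum_add_distrib])
    (by intros; simp [LinearMap.comp_smul, Finset.mul_sum])

theorem trPair_apply (l : ∀ i, W i 2 →ₗ[ℂ] V i 0) (φ : ∀ k, V k 0 →ₗ[ℂ] W k 2) :
    trPair V W l φ = ∑ k, LinearMap.trace ℂ (V k 0) (l k ∘ₗ φ k) := rfl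

theorem eq_zero_of_trace {A B : Type} [AddCommGroup A] [Module ℂ A] [AddCommGroup B] [Module ℂ B]
    [FiniteDimensional ℂ A] (X : B →ₗ[ℂ] A)
    (h : ∀ φ : A →ₗ[ℂ] B, LinearMap.trace ℂ A (X ∘ₗ φ) = 0) : X = 0 := by
  ext w
  rw [LinearMap.zero_apply, ← Module.forall_dual_apply_eq_zero_iff ℂ]
  intro f
  have := h (f.smulRight w)
  have e : X ∘ₗ f.smulRight w = f.smulRight (X w) := by ext; simp
  rw [e, LinearMap.trace_smulRight] at this
  exact this

theorem comp_sum_aux {A B C : Type} [AddCommGroup A] [Module ℂ A] [AddCommGroup B] [Module ℂ B]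
    [AddCommGroup C] [Module ℂ C] (X : B →ₗ[ℂ] C) (f : H → (A →ₗ[ℂ] B)) :
    X ∘ₗ (∑ h, f h) = ∑ h, X ∘ₗ f h := by
  ext; simp [LinearMap.sum_apply]

theorem trPair_inj [∀ i n, FiniteDimensional ℂ (V i n)] : Function.Injective (trPair V W) := by
  rw [injective_iff_map_eq_zero]
  intro l hl
  funext k
  apply eq_zero_of_trace
  intro φ
  have := LinearMap.congr_fun hl (Pi.single k φ)
  rw [trPair_apply, Fintype.sum_eq_single k] at this
  · simpa using this
  · intro j hj
    simp [Pi.single_eq_of_ne hj]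

theorem trace_first [∀ i n, FiniteDimensional ℂ (V i n)] (l : ∀ i, W i 2 →ₗ[ℂ] V i 0)
    (ψ : ∀ h, V (s h) 0 →ₗ[ℂ] W (t h) 1) (h g g' : H) (e : g' = g)
    (hs' : s g' = t h) (ht' : t g' = s h) (hs : s g = t h) (ht : t g = s h) :
    LinearMap.trace ℂ (V (t h) 0) (l (t h) ∘ₗ aW h 1 ∘ₗ (lcastN W 1 ht').toLinearMap ∘ₗ
      ψ g' ∘ₗ (lcastN V 0 hs').symm.toLinearMap) =
    LinearMap.trace ℂ (V (s g) 0) ((l (s g) ∘ₗ (lcastN W 2 hs.symm).toLinearMap ∘ₗ aW h 1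
      ∘ₗ (lcastN W 1 ht.symm).symm.toLinearMap) ∘ₗ ψ g) := by
  subst e
  generalize ψ g' = f
  generalize aW h 1 = a
  revert f a
  generalize s g' = p at *
  generalize t g' = q at *
  subst hs ht
  intro f a
  rfl

theorem trPair_d1L [∀ i n, FiniteDimensional ℂ (V i n)]
    (bar_invol : ∀ h, bar (bar h) = h)
    (eps_bar : ∀ h, eps (bar h) = - eps h)
    (l : ∀ i, W i 2 →ₗ[ℂ] V i 0) (ψ : ∀ h, V (s h) 0 →ₗ[ℂ] W (t h) 1) :
    trPair V W l (d1L s t bar s_bar t_bar eps V W aV aW eW eVinv ψ) =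
      ∑ g, (eps g : ℂ) * LinearMap.trace ℂ (V (s g) 0)
        (auxX s t bar s_bar t_bar V W aV aW eW eVinv l g ∘ₗ ψ g) := by
  have h1 : trPair V W l (d1L s t bar s_bar t_bar eps V W aV aW eW eVinv ψ) =
      ∑ h, ((eps h : ℂ) * LinearMap.trace ℂ (V (t h) 0) (l (t h) ∘ₗ aW h 1 ∘ₗ
          (lcastN W 1 (t_bar h)).toLinearMap ∘ₗ
          ψ (bar h) ∘ₗ (lcastN V 0 (s_bar h)).symm.toLinearMap)
        + (eps h : ℂ) * LinearMap.trace ℂ (V (t h) 0) ((l (t h) ∘ₗ eW (t h) 1 ∘ₗ ψ h) ∘ₗ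
          (eVinv (s h) 0 ∘ₗ (lcastN V 1 (t_bar h)).toLinearMap ∘ₗ aV (bar h) 0
            ∘ₗ (lcastN V 0 (s_bar h)).symm.toLinearMap))) := by
    rw [trPair_apply]
    unfold d1L
    simp only [LinearMap.pi_apply, LinearMap.sum_apply, comp_sum_aux, map_sum]
    rw [Finset.sum_comm]
    refine Finset.sum_congr rfl fun h _ => ?_
    rw [Fintype.sum_eq_single (t h)]
    · rw [dif_pos rfl, ← mul_add, ← map_add, ← smul_eq_mul, ← map_smul]
      congr 1
      ext x
      simp [lcastN_rfl]
    · intro k hk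
      rw [dif_neg (Ne.symm hk)]
      simp
  rw [h1, Finset.sum_add_distrib]
  have h2 : ∑ h, ((eps h : ℂ) * LinearMap.trace ℂ (V (t h) 0) (l (t h) ∘ₗ aW h 1 ∘ₗ
          (lcastN W 1 (t_bar h)).toLinearMap ∘ₗ
          ψ (bar h) ∘ₗ (lcastN V 0 (s_bar h)).symm.toLinearMap)) =
      ∑ g, -((eps g : ℂ) * LinearMap.trace ℂ (V (s g) 0)
        ((l (s g) ∘ₗ (lcastN W 2 (t_bar g)).toLinearMap ∘ₗ aW (bar g) 1
          ∘ₗ (lcastN W 1 (s_bar g)).symm.toLinearMap) ∘ₗ ψ g)) := by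
    rw [← Equiv.sum_comp (Function.Involutive.toPerm bar bar_invol)]
    refine Finset.sum_congr rfl fun g _ => ?_
    change (eps (bar g) : ℂ) * LinearMap.trace ℂ (V (t (bar g)) 0) (l (t (bar g)) ∘ₗ aW (bar g) 1 ∘ₗ
          (lcastN W 1 (t_bar (bar g))).toLinearMap ∘ₗ
          ψ (bar (bar g)) ∘ₗ (lcastN V 0 (s_bar (bar g))).symm.toLinearMap) = _
    rw [trace_first s t V W aW l ψ (bar g) g (bar (bar g)) (bar_invol g) _ _
      (t_bar g).symm (s_bar g).symm, eps_bar]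
    simp
  rw [h2, ← Finset.sum_add_distrib]
  refine Finset.sum_congr rfl fun g _ => ?_
  rw [LinearMap.trace_comp_comm' _ (l (t g) ∘ₗ eW (t g) 1 ∘ₗ ψ g)]
  unfold auxX
  rw [LinearMap.sub_comp, map_sub, mul_sub, neg_add_eq_sub]
  rfl

theorem trPair_mem_iff [∀ i n, FiniteDimensional ℂ (V i n)]
    (bar_invol : ∀ h, bar (bar h) = h)
    (eps_pm : ∀ h, eps h = 1 ∨ eps h = -1)
    (eps_bar : ∀ h, eps (bar h) = - eps h)
    (l : ∀ i, W i 2 →ₗ[ℂ] V i 0) :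
    trPair V W l ∈
      (LinearMap.range (d1L s t bar s_bar t_bar eps V W aV aW eW eVinv)).dualAnnihilator ↔
    l ∈ Ksub s t bar s_bar t_bar V W aV aW eW eVinv := by
  classical
  rw [mem_Ksub_iff, Submodule.mem_dualAnnihilator]
  constructor
  · intro hl g
    apply eq_zero_of_trace
    intro φ
    have := hl _ ⟨Pi.single g φ, rfl⟩
    rw [trPair_d1L s t bar s_bar t_bar eps V W aV aW eW eVinv bar_invol eps_bar,
      Fintype.sum_eq_single g] at this
    · have he : (eps g : ℂ) ≠ 0 := by rcases eps_pm g with h | h <;> simp [h]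
      simpa [he] using this
    · intro j hj
      simp [Pi.single_eq_of_ne hj]
  · rintro hl _ ⟨ψ, rfl⟩
    rw [trPair_d1L s t bar s_bar t_bar eps V W aV aW eW eVinv bar_invol eps_bar]
    simp [hl]

def lamMap : (∀ (i : I) (n : Fin 3), W i (n : ℕ) →ₗ[ℂ] V i (n : ℕ)) →ₗ[ℂ]
    (∀ i, W i 2 →ₗ[ℂ] V i 0) where
  toFun μ := fun i => eVinv i 0 ∘ₗ eVinv i 1 ∘ₗ μ i 2
  map_add' := by intros; ext; simp
  map_smul' := by intros; ext; simp

end Aux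

/-- (`N = 2`.)  The map `μ ↦ ((e^V_{i,0})⁻¹∘(e^V_{i,1})⁻¹∘μ_{i,2})ᵢ` is a
(linear) bijection from the space of graded homomorphisms `W → V` onto `K`; consequently the
cokernel of `∂₁` is isomorphic to the dual of the space of graded homomorphisms `W → V`. -/
theorem stmt13
    {I H : Type} [Fintype I] [Fintype H] [DecidableEq I]
    (s t : H → I) (bar : H → H)
    (bar_invol : ∀ h, bar (bar h) = h) (bar_ne : ∀ h, bar h ≠ h)
    (s_bar : ∀ h, s (bar h) = t h) (t_bar : ∀ h, t (bar h) = s h)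
    (eps : H → ℤ) (eps_pm : ∀ h, eps h = 1 ∨ eps h = -1)
    (eps_bar : ∀ h, eps (bar h) = - eps h)
    (V W : I → ℕ → Type)
    [∀ i n, AddCommGroup (V i n)] [∀ i n, Module ℂ (V i n)]
    [∀ i n, FiniteDimensional ℂ (V i n)]
    [∀ i n, AddCommGroup (W i n)] [∀ i n, Module ℂ (W i n)]
    [∀ i n, FiniteDimensional ℂ (W i n)]
    (aV : ∀ (h : H) (n : ℕ), V (s h) n →ₗ[ℂ] V (t h) (n + 1))
    (eV : ∀ (i : I) (n : ℕ), V i n →ₗ[ℂ] V i (n + 1))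
    (aW : ∀ (h : H) (n : ℕ), W (s h) n →ₗ[ℂ] W (t h) (n + 1))
    (eW : ∀ (i : I) (n : ℕ), W i n →ₗ[ℂ] W i (n + 1))
    -- (R1) for V and W (N = 2, so only n = 0)
    (hR1V : ∀ (k : I) (n : ℕ), n + 2 ≤ 2 →
      (∑ h : H, if hk : s h = k then
        (eps h : ℂ) • ((lcastN V (n + 2) ((t_bar h).trans hk)).toLinearMap
          ∘ₗ aV (bar h) (n + 1) ∘ₗ (lcastN V (n + 1) (s_bar h)).symm.toLinearMap
          ∘ₗ aV h n ∘ₗ (lcastN V n hk).symm.toLinearMap) else 0) = 0)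
    (hR1W : ∀ (k : I) (n : ℕ), n + 2 ≤ 2 →
      (∑ h : H, if hk : s h = k then
        (eps h : ℂ) • ((lcastN W (n + 2) ((t_bar h).trans hk)).toLinearMap
          ∘ₗ aW (bar h) (n + 1) ∘ₗ (lcastN W (n + 1) (s_bar h)).symm.toLinearMap
          ∘ₗ aW h n ∘ₗ (lcastN W n hk).symm.toLinearMap) else 0) = 0)
    -- (R2) for V and W
    (hR2V : ∀ (h : H) (n : ℕ), n + 2 ≤ 2 →
      eV (t h) (n + 1) ∘ₗ aV h n = aV h (n + 1) ∘ₗ eV (s h) n)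
    (hR2W : ∀ (h : H) (n : ℕ), n + 2 ≤ 2 →
      eW (t h) (n + 1) ∘ₗ aW h n = aW h (n + 1) ∘ₗ eW (s h) n)
    -- the e^V are invertible, with inverses eVinv
    (eVinv : ∀ (i : I) (n : ℕ), V i (n + 1) →ₗ[ℂ] V i n)
    (hinv : ∀ (i : I) (n : ℕ), n + 1 ≤ 2 →
      eVinv i n ∘ₗ eV i n = LinearMap.id ∧ eV i n ∘ₗ eVinv i n = LinearMap.id) :
    -- μ ↦ λ is a bijection from the graded homomorphisms W → V onto K
    Set.BijOn
      (fun (μ : ∀ (i : I) (n : Fin 3), W i (n : ℕ) →ₗ[ℂ] V i (n : ℕ)) =>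
        (fun i => eVinv i 0 ∘ₗ eVinv i 1 ∘ₗ μ i ⟨2, by omega⟩ : ∀ i, W i 2 →ₗ[ℂ] V i 0))
      (GHomWV s t V W aV eV aW eW : Set _)
      (Ksub s t bar s_bar t_bar V W aV aW eW eVinv : Set _)
    ∧
    -- consequently, coker ∂₁ is isomorphic to the dual of the space of graded homs W → V
    Nonempty
      (((∀ k, V k 0 →ₗ[ℂ] W k 2)
          ⧸ LinearMap.range (d1L s t bar s_bar t_bar eps V W aV aW eW eVinv))
        ≃ₗ[ℂ] Module.Dual ℂ (GHomWV s t V W aV eV aW eW)) := by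
  have inv1 : ∀ i n, n + 1 ≤ 2 → ∀ x, eVinv i n (eV i n x) = x := fun i n hn x =>
    LinearMap.congr_fun (hinv i n hn).1 x
  have inv2 : ∀ i n, n + 1 ≤ 2 → ∀ x, eV i n (eVinv i n x) = x := fun i n hn x =>
    LinearMap.congr_fun (hinv i n hn).2 x
  have r2V : ∀ h x, eV (t h) 1 (aV h 0 x) = aV h 1 (eV (s h) 0 x) := fun h x =>
    LinearMap.congr_fun (hR2V h 0 le_rfl) x
  have r2W : ∀ h x, eW (t h) 1 (aW h 0 x) = aW h 1 (eW (s h) 0 x) := fun h x =>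
    LinearMap.congr_fun (hR2W h 0 le_rfl) x
  have i10 := fun i => inv1 i 0 (by omega)
  have i11 := fun i => inv1 i 1 (by omega)
  have i20 := fun i => inv2 i 0 (by omega)
  have i21 := fun i => inv2 i 1 (by omega)
  have r2V' : ∀ h x, eVinv (t h) 1 (aV h 1 x) = aV h 0 (eVinv (s h) 0 x) := by
    intro h x
    have := r2V h (eVinv (s h) 0 x)
    rw [i20] at this
    rw [← this, i11]
  have hB : Set.BijOn
      (fun (μ : ∀ (i : I) (n : Fin 3), W i (n : ℕ) →ₗ[ℂ] V i (n : ℕ)) =>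
        (fun i => eVinv i 0 ∘ₗ eVinv i 1 ∘ₗ μ i ⟨2, by omega⟩ : ∀ i, W i 2 →ₗ[ℂ] V i 0))
      (GHomWV s t V W aV eV aW eW : Set _)
      (Ksub s t bar s_bar t_bar V W aV aW eW eVinv : Set _) := by
    refine ⟨?_, ?_, ?_⟩
    · intro μ hμ
      rw [SetLike.mem_coe, mem_GHom_iff] at hμ
      rw [SetLike.mem_coe, mem_Ksub_iff' s t bar s_bar t_bar V W aV aW eW eVinv bar_invol]
      obtain ⟨he, ha⟩ := hμ
      intro g x
      change eVinv (t g) 0 (aV g 0 (eVinv (s g) 0 (eVinv (s g) 1 (μ (s g) 2 (eW (s g) 1 x))))) =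
        eVinv (t g) 0 (eVinv (t g) 1 (μ (t g) 2 (aW g 1 x)))
      rw [(ha g).2 x, (he (s g)).2 x]
      erw [i11, r2V']
    · intro μ hμ ν hν h
      rw [SetLike.mem_coe, mem_GHom_iff] at hμ hν
      have h2 : ∀ i x, μ i 2 x = ν i 2 x := by
        intro i x
        have h3 : eVinv i 0 (eVinv i 1 (μ i 2 x)) = eVinv i 0 (eVinv i 1 (ν i 2 x)) :=
          LinearMap.congr_fun (congr_fun h i) x
        have h4 := congrArg (fun y => eV i 1 (eV i 0 y)) h3
        simp only [i20] at h4
        erw [i21, i21] at h4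
        exact h4
      have h1 : ∀ i x, μ i 1 x = ν i 1 x := by
        intro i x
        have h3 : eV i 1 (μ i 1 x) = eV i 1 (ν i 1 x) := by
          rw [← (hμ.1 i).2 x, ← (hν.1 i).2 x]; exact h2 _ _
        exact (Function.LeftInverse.injective (i11 i)) h3
      have h0 : ∀ i x, μ i 0 x = ν i 0 x := by
        intro i x
        have h3 : eV i 0 (μ i 0 x) = eV i 0 (ν i 0 x) := by
          rw [← (hμ.1 i).1 x, ← (hν.1 i).1 x]; exact h1 _ _
        exact (Function.LeftInverse.injective (i10 i)) h3
      funext i n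
      apply LinearMap.ext
      fin_cases n
      · exact h0 i
      · exact h1 i
      · exact h2 i
    · intro l hl
      rw [SetLike.mem_coe, mem_Ksub_iff' s t bar s_bar t_bar V W aV aW eW eVinv bar_invol] at hl
      let μ : ∀ (i : I) (n : Fin 3), W i (n : ℕ) →ₗ[ℂ] V i (n : ℕ) := fun i n =>
        match n with
        | ⟨0, _⟩ => l i ∘ₗ eW i 1 ∘ₗ eW i 0
        | ⟨1, _⟩ => eV i 0 ∘ₗ l i ∘ₗ eW i 1
        | ⟨2, _⟩ => eV i 1 ∘ₗ eV i 0 ∘ₗ l i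
      have ha1 : ∀ h x, eV (t h) 1 (eV (t h) 0 (l (t h) (aW h 1 x))) =
          aV h 1 (eV (s h) 0 (l (s h) (eW (s h) 1 x))) := by
        intro h x
        rw [← hl, i20, r2V]
      refine ⟨μ, ?_, ?_⟩
      · rw [SetLike.mem_coe, mem_GHom_iff]
        refine ⟨fun i => ⟨fun x => rfl, fun x => rfl⟩, fun h => ⟨fun x => ?_, fun x => ha1 h x⟩⟩
        change eV (t h) 0 (l (t h) (eW (t h) 1 (aW h 0 x))) =
          aV h 0 (l (s h) (eW (s h) 1 (eW (s h) 0 x)))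
        rw [r2W, ← hl, i20]
      · funext i
        apply LinearMap.ext
        intro x
        change eVinv i 0 (eVinv i 1 (eV i 1 (eV i 0 (l i x)))) = l i x
        rw [i11, i10]
  refine ⟨hB, ?_⟩
  have hGK : Module.finrank ℂ (GHomWV s t V W aV eV aW eW) =
      Module.finrank ℂ (Ksub s t bar s_bar t_bar V W aV aW eW eVinv) := by
    refine LinearEquiv.finrank_eq (LinearEquiv.ofBijective
      ((lamMap V W eVinv).restrict (p := GHomWV s t V W aV eV aW eW)
        (q := Ksub s t bar s_bar t_bar V W aV aW eW eVinv) hB.mapsTo) ?_)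
    exact hB.bijective
  have hT : Function.Bijective (trPair V W) := by
    refine ⟨trPair_inj V W, ?_⟩
    refine (LinearMap.injective_iff_surjective_of_finrank_eq_finrank ?_).1 (trPair_inj V W)
    rw [Subspace.dual_finrank_eq, Module.finrank_pi_fintype, Module.finrank_pi_fintype]
    refine Finset.sum_congr rfl fun i _ => ?_
    rw [Module.finrank_linearMap, Module.finrank_linearMap, mul_comm]
  let T := LinearEquiv.ofBijective (trPair V W) hT
  set R := LinearMap.range (d1L s t bar s_bar t_bar eps V W aV aW eW eVinv) with hR
  have hK : (Ksub s t bar s_bar t_bar V W aV aW eW eVinv) =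
      R.dualAnnihilator.comap T.toLinearMap := by
    ext l
    exact (trPair_mem_iff s t bar s_bar t_bar eps V W aV aW eW eVinv bar_invol eps_pm eps_bar
      l).symm
  have hKR : Module.finrank ℂ (Ksub s t bar s_bar t_bar V W aV aW eW eVinv) =
      Module.finrank ℂ R.dualAnnihilator := by
    rw [hK]
    exact (T.ofSubmodule' R.dualAnnihilator).finrank_eq
  refine ⟨LinearEquiv.ofFinrankEq _ _ ?_⟩
  rw [Subspace.dual_finrank_eq, hGK, hKR, ← R.dualQuotEquivDualAnnihilator.finrank_eq,
    Subspace.dual_finrank_eq]
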